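/- Let (R, m, k) be a commutative noetherian local ring. Then R is Tor-persistent if and only if the m-adic completion R̂ of R is Tor-persistent. -/

import Mathlib

open CategoryTheory CategoryTheory.Limits

universe u

/-- An `R`-module `M` has finite projective dimension if it admits a projective
resolution that vanishes in all sufficiently high degrees. -/
def HasFiniteProjDim (R : Type u) [CommRing R] (M : ModuleCat.{u} R) : Prop :=
  ∃ (n : ℕ) (P : CategoryTheory.ProjectiveResolution M),
    ∀ i, n < i → IsZero (P.complex.X i)

/-- A commutative ring `R` is Tor-persistent if every finitely generated `R`-module `M`
with `Tor_i^R(M, M) = 0` for all sufficiently large `i` has finite projective dimension. -/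
def TorPersistent (R : Type u) [CommRing R] : Prop :=
  ∀ M : ModuleCat.{u} R, Module.Finite R M →
    (∃ N : ℕ, ∀ i, N ≤ i → Subsingleton (((Tor (ModuleCat.{u} R) i).obj M).obj M)) →
    HasFiniteProjDim R M

section Splice

namespace CategoryTheory.ProjectiveResolution

variable {C : Type*} [Category* C] [Abelian C]

/-- The augmentation of a projective resolution, as a morphism to the resolved object. -/
noncomputable def aug {Z : C} (Q : ProjectiveResolution Z) : Q.complex.X 0 ⟶ Z := Q.π.f 0

lemma d_comp_aug {Z : C} (Q : ProjectiveResolution Z) : Q.complex.d 1 0 ≫ Q.aug = 0 :=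
  Q.complex_d_comp_π_f_zero

instance {Z : C} (Q : ProjectiveResolution Z) : Epi Q.aug := inferInstanceAs (Epi (Q.π.f 0))

lemma exact_aug {Z : C} (Q : ProjectiveResolution Z) :
    (ShortComplex.mk _ _ Q.d_comp_aug).Exact := Q.exact₀

/-- The complex obtained by splicing a projective resolution of `S.X₁` with `S.X₁ ⟶ S.X₂`. -/
noncomputable abbrev spliceComplex (S : ShortComplex C) (Q : ProjectiveResolution S.X₁) :
    ChainComplex C ℕ :=
  Q.complex.augment (Q.aug ≫ S.f) (by rw [← Category.assoc, Q.d_comp_aug, zero_comp])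

lemma aug_comp_comp {S : ShortComplex C} (Q : ProjectiveResolution S.X₁) :
    (Q.aug ≫ S.f) ≫ S.g = 0 := by
  rw [Category.assoc, S.zero, comp_zero]

lemma exact_aug_comp {S : ShortComplex C} (hS : S.ShortExact) (Q : ProjectiveResolution S.X₁) :
    (ShortComplex.mk (Q.aug ≫ S.f) S.g Q.aug_comp_comp).Exact := by
  let α : ShortComplex.mk (Q.aug ≫ S.f) S.g Q.aug_comp_comp ⟶ S :=
    { τ₁ := Q.aug
      τ₂ := 𝟙 _
      τ₃ := 𝟙 _ }
  have : Epi α.τ₁ := inferInstanceAs (Epi Q.aug)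
  have : IsIso α.τ₂ := inferInstanceAs (IsIso (𝟙 _))
  have : Mono α.τ₃ := inferInstanceAs (Mono (𝟙 _))
  exact (ShortComplex.exact_iff_of_epi_of_isIso_of_mono α).2 hS.exact

lemma spliceComplex_exact_one {S : ShortComplex C} (hS : S.ShortExact)
    (Q : ProjectiveResolution S.X₁) : ((spliceComplex S Q).sc' 2 1 0).Exact := by
  have := hS.mono_f
  let α : ShortComplex.mk _ _ Q.d_comp_aug ⟶ (spliceComplex S Q).sc' 2 1 0 :=
    { τ₁ := 𝟙 (Q.complex.X 1)
      τ₂ := 𝟙 (Q.complex.X 0)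
      τ₃ := S.f
      comm₁₂ := (Category.id_comp (Q.complex.d 1 0)).trans
        (Category.comp_id (Q.complex.d 1 0)).symm
      comm₂₃ := Category.id_comp (Q.aug ≫ S.f) }
  have : Epi α.τ₁ := inferInstanceAs (Epi (𝟙 _))
  have : IsIso α.τ₂ := inferInstanceAs (IsIso (𝟙 _))
  have : Mono α.τ₃ := inferInstanceAs (Mono S.f)
  exact (ShortComplex.exact_iff_of_epi_of_isIso_of_mono α).1 Q.exact_aug

/-- Splicing a projective resolution of the kernel of an epimorphism `F ⟶ N` with `F`
projective yields a projective resolution of `N`. -/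
noncomputable def splice {S : ShortComplex C}
    (hS : S.ShortExact) [Projective S.X₂] (Q : ProjectiveResolution S.X₁) :
    ProjectiveResolution S.X₃ where
  complex := spliceComplex S Q
  projective n := by
    cases n
    · assumption
    · exact Q.projective _
  π := (ChainComplex.toSingle₀Equiv _ _).symm ⟨S.g, by
    rw [ChainComplex.augment_d_one_zero]
    exact Q.aug_comp_comp⟩
  quasiIso := ⟨fun n => by
    have := hS.epi_g
    cases n with
    | zero =>
      rw [ChainComplex.quasiIsoAt₀_iff, ShortComplex.quasiIso_iff_of_zeros']
      · refine (ShortComplex.exact_and_epi_g_iff_of_iso ?_).2 ⟨Q.exact_aug_comp hS, ‹_›⟩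
        refine ShortComplex.isoMk (Iso.refl _) (Iso.refl _) (Iso.refl _) ?_ ?_
        · exact (Category.id_comp _).trans (Category.comp_id _).symm
        · refine Eq.trans (Category.id_comp S.g) ?_
          refine Eq.trans ?_ (Category.comp_id _).symm
          exact (ChainComplex.toSingle₀Equiv_symm_apply_f_zero (C := spliceComplex S Q)
            (X := S.X₃) S.g _).symm
      all_goals rfl
    | succ n =>
      rw [quasiIsoAt_iff_exactAt']
      · rw [HomologicalComplex.exactAt_iff' _ (n + 1 + 1) (n + 1) n (by simp) (by simp)]
        cases n with
        | zero => exact Q.spliceComplex_exact_one hS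
        | succ n => exact Q.exact_succ n
      · apply ChainComplex.exactAt_succ_single_obj⟩

end CategoryTheory.ProjectiveResolution

end Splice

section FiniteProjDim

variable {R : Type u} [CommRing R]

lemma exists_projectiveResolution_of_hasProjectiveDimensionLE (n : ℕ) (M : ModuleCat.{u} R)
    (h : HasProjectiveDimensionLE M n) :
    ∃ P : ProjectiveResolution M, ∀ i, n < i → IsZero (P.complex.X i) := by
  induction n generalizing M with
  | zero =>
    have : Projective M := (projective_iff_hasProjectiveDimensionLE_zero M).2 h
    refine ⟨ProjectiveResolution.self M, fun i hi => ?_⟩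
    exact HomologicalComplex.isZero_single_obj_X _ _ _ _ (by omega)
  | succ n ih =>
    have hS := M.shortExact_projectiveShortComplex
    obtain ⟨Q, hQ⟩ := ih _ ((hS.hasProjectiveDimensionLT_X₃_iff n inferInstance).1 h)
    refine ⟨ProjectiveResolution.splice hS Q, fun i hi => ?_⟩
    cases i with
    | zero => omega
    | succ i => exact hQ i (by omega)

lemma hasFiniteProjDim_iff (M : ModuleCat.{u} R) :
    HasFiniteProjDim R M ↔ ∃ n, HasProjectiveDimensionLT M n := by
  constructor
  · rintro ⟨n, P, hP⟩
    refine ⟨n + 1, (hasProjectiveDimensionLT_iff M (n + 1)).2 fun i hi Y e => ?_⟩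
    obtain ⟨f, hf, rfl⟩ := P.extMk_surjective e (i + 1) rfl
    obtain rfl : f = 0 := (hP i (by omega)).eq_of_src _ _
    simp
  · rintro ⟨n, h⟩
    have : HasProjectiveDimensionLE M n := hasProjectiveDimensionLT_of_ge M n (n + 1) (by omega)
    exact ⟨n, exists_projectiveResolution_of_hasProjectiveDimensionLE n M this⟩

end FiniteProjDim

section TorVanishing

variable (R : Type u) [CommRing R]

/-- Vanishing of `Tor_n^R(M, N)`. -/
def TorVanishes (n : ℕ) (M N : Type u) [AddCommGroup M] [Module R M] [AddCommGroup N]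
    [Module R N] : Prop :=
  Subsingleton (((Tor (ModuleCat.{u} R) n).obj (ModuleCat.of R M)).obj (ModuleCat.of R N))

variable {R}

open MonoidalCategory in
lemma torVanishes_succ_iff_exact (M : Type u) [AddCommGroup M] [Module R M]
    (N : ModuleCat.{u} R) (P : ProjectiveResolution N) (n : ℕ) :
    TorVanishes R (n + 1) M N ↔
      Function.Exact ((P.complex.d (n + 2) (n + 1)).hom.lTensor M)
        ((P.complex.d (n + 1) n).hom.lTensor M) := by
  have e := P.isoLeftDerivedObj ((tensoringLeft (ModuleCat.{u} R)).obj (ModuleCat.of R M)) (n + 1)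
  rw [TorVanishes, ← ModuleCat.isZero_iff_subsingleton]
  refine (e.isZero_iff).trans ?_
  refine (HomologicalComplex.exactAt_iff_isZero_homology _ _).symm.trans ?_
  rw [HomologicalComplex.exactAt_iff' _ (n + 2) (n + 1) n (by simp) (by simp)]
  exact ShortComplex.ShortExact.moduleCat_exact_iff_function_exact _

variable {M N K F : Type u} [AddCommGroup M] [Module R M] [AddCommGroup N] [Module R N]
  [AddCommGroup K] [Module R K] [AddCommGroup F] [Module R F]

lemma shortExact_of_linearMap {f : K →ₗ[R] F} {g : F →ₗ[R] N} (hf : Function.Injective f)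
    (hfg : Function.Exact f g) (hg : Function.Surjective g) :
    (ShortComplex.mk (ModuleCat.ofHom f) (ModuleCat.ofHom g)
      (by ext x; exact hfg.apply_apply_eq_zero x)).ShortExact := by
  refine ShortComplex.ShortExact.mk' ?_ ?_ ?_
  · exact (ShortComplex.ShortExact.moduleCat_exact_iff_function_exact _).2 hfg
  · exact (ModuleCat.mono_iff_injective _).2 hf
  · exact (ModuleCat.epi_iff_surjective _).2 hg

/-- Dimension shifting in the second variable. -/
lemma torVanishes_add_two_iff [Module.Projective R F] {f : K →ₗ[R] F} {g : F →ₗ[R] N}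
    (hf : Function.Injective f) (hfg : Function.Exact f g) (hg : Function.Surjective g) (n : ℕ) :
    TorVanishes R (n + 2) M N ↔ TorVanishes R (n + 1) M K := by
  have hS := shortExact_of_linearMap hf hfg hg
  have : Projective (ModuleCat.of R F) := (IsProjective.iff_projective F).1 ‹_›
  let Q := ProjectiveResolution.of (ModuleCat.of R K)
  exact (torVanishes_succ_iff_exact M (ModuleCat.of R N)
    (ProjectiveResolution.splice (hS := hS) (Q := Q)) (n + 1)).trans
    (torVanishes_succ_iff_exact M (ModuleCat.of R K) Q n).symm

lemma torVanishes_one_iff [Module.Projective R F] {f : K →ₗ[R] F} {g : F →ₗ[R] N}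
    (hf : Function.Injective f) (hfg : Function.Exact f g) (hg : Function.Surjective g) :
    TorVanishes R 1 M N ↔ Function.Injective (f.lTensor M) := by
  have hS := shortExact_of_linearMap hf hfg hg
  have : Projective (ModuleCat.of R F) := (IsProjective.iff_projective F).1 ‹_›
  let Q := ProjectiveResolution.of (ModuleCat.of R K)
  have hsurj : Function.Surjective Q.aug.hom :=
    (ModuleCat.epi_iff_surjective Q.aug).1 inferInstance
  have hexact : Function.Exact (Q.complex.d 1 0).hom Q.aug.hom :=
    (ShortComplex.ShortExact.moduleCat_exact_iff_function_exact _).1 Q.exact_aug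
  have h1 := lTensor_exact M hexact hsurj
  have h2 := LinearMap.lTensor_surjective M hsurj
  refine (torVanishes_succ_iff_exact M (ModuleCat.of R N)
    (ProjectiveResolution.splice (hS := hS) (Q := Q)) 0).trans ?_
  change Function.Exact ((Q.complex.d 1 0).hom.lTensor M) ((f ∘ₗ Q.aug.hom).lTensor M) ↔ _
  rw [LinearMap.lTensor_comp]
  constructor
  · intro h
    rw [injective_iff_map_eq_zero]
    intro x hx
    obtain ⟨y, rfl⟩ := h2 x
    obtain ⟨z, rfl⟩ := (h y).1 hx
    exact h1.apply_apply_eq_zero z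
  · intro h y
    rw [← h1 y, LinearMap.comp_apply]
    exact map_eq_zero_iff _ h

end TorVanishing

section TorAlgebra

variable {R : Type u} [CommRing R]

lemma exists_free_cover (N : Type u) [AddCommGroup N] [Module R N] :
    ∃ (K F : ModuleCat.{u} R) (f : K →ₗ[R] F) (g : F →ₗ[R] N), Module.Free R F ∧
      Function.Injective f ∧ Function.Exact f g ∧ Function.Surjective g := by
  let g := Finsupp.linearCombination R (id : N → N)
  exact ⟨ModuleCat.of R (LinearMap.ker g), ModuleCat.of R (N →₀ R), (LinearMap.ker g).subtype, g,
    inferInstanceAs (Module.Free R (N →₀ R)), Subtype.val_injective, LinearMap.exact_subtype_ker_map g,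
    Finsupp.linearCombination_id_surjective R N⟩

variable {M N K F X Y Z L G : Type u} [AddCommGroup M] [Module R M] [AddCommGroup N] [Module R N]
  [AddCommGroup K] [Module R K] [AddCommGroup F] [Module R F] [AddCommGroup X] [Module R X]
  [AddCommGroup Y] [Module R Y] [AddCommGroup Z] [Module R Z] [AddCommGroup L] [Module R L]
  [AddCommGroup G] [Module R G]

lemma rTensor_injective_of_lTensor_injective [Module.Flat R F]
    {a : X →ₗ[R] Y} {b : Y →ₗ[R] Z}
    (ha : Function.Injective a) (hab : Function.Exact a b) (hb : Function.Surjective b)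
    {f : K →ₗ[R] F} {g : F →ₗ[R] N}
    (hfg : Function.Exact f g) (hg : Function.Surjective g)
    (h : Function.Injective (f.lTensor Z)) : Function.Injective (a.rTensor N) := by
  rw [injective_iff_map_eq_zero]
  intro z hz
  obtain ⟨w, rfl⟩ := LinearMap.lTensor_surjective X hg z
  have comm {P Q S T : Type u} [AddCommGroup P] [Module R P] [AddCommGroup Q] [Module R Q]
      [AddCommGroup S] [Module R S] [AddCommGroup T] [Module R T] (p : P →ₗ[R] Q) (q : S →ₗ[R] T)
      (x) : p.rTensor T (q.lTensor P x) = q.lTensor Q (p.rTensor S x) := by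
    rw [← LinearMap.comp_apply, ← LinearMap.comp_apply, LinearMap.rTensor_comp_lTensor,
      LinearMap.lTensor_comp_rTensor]
  rw [comm] at hz
  obtain ⟨v, hv⟩ := (lTensor_exact Y hfg hg _).1 hz
  have h1 : f.lTensor Z (b.rTensor K v) = 0 := by
    rw [← comm, hv]
    exact (rTensor_exact F hab hb).apply_apply_eq_zero w
  obtain ⟨t, rfl⟩ := (rTensor_exact K hab hb v).1 (h (h1.trans (map_zero _).symm))
  rw [← comm] at hv
  rw [← Module.Flat.rTensor_preserves_injective_linearMap a ha hv]
  exact (lTensor_exact X hfg hg).apply_apply_eq_zero t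

lemma torVanishes_one_symm (h : TorVanishes R 1 M N) : TorVanishes R 1 N M := by
  obtain ⟨K, F, f, g, _, hf, hfg, hg⟩ := exists_free_cover (R := R) N
  obtain ⟨L, G, a, b, _, ha, hab, hb⟩ := exists_free_cover (R := R) M
  rw [torVanishes_one_iff ha hab hb, LinearMap.lTensor_inj_iff_rTensor_inj]
  rw [torVanishes_one_iff hf hfg hg] at h
  exact rTensor_injective_of_lTensor_injective ha hab hb hfg hg h

lemma torVanishes_one_comm : TorVanishes R 1 M N ↔ TorVanishes R 1 N M :=
  ⟨torVanishes_one_symm, torVanishes_one_symm⟩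

lemma torVanishes_syzygy_iff [Module.Projective R F] [Module.Projective R G] {f : K →ₗ[R] F}
    {g : F →ₗ[R] N} (hf : Function.Injective f) (hfg : Function.Exact f g)
    (hg : Function.Surjective g) {a : L →ₗ[R] G} {b : G →ₗ[R] M} (ha : Function.Injective a)
    (hab : Function.Exact a b) (hb : Function.Surjective b) (n : ℕ) :
    TorVanishes R (n + 1) K M ↔ TorVanishes R (n + 1) N L := by
  induction n generalizing M L G with
  | zero =>
    rw [torVanishes_one_iff ha hab hb, torVanishes_one_comm, torVanishes_one_iff hf hfg hg]
    have h1 : Function.Injective (f.rTensor G) :=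
      Module.Flat.rTensor_preserves_injective_linearMap f hf
    have h2 : Function.Injective (a.rTensor F) :=
      Module.Flat.rTensor_preserves_injective_linearMap a ha
    rw [← LinearMap.lTensor_inj_iff_rTensor_inj] at h2
    rw [LinearMap.lTensor_inj_iff_rTensor_inj (M := L)]
    have : f.rTensor G ∘ a.lTensor K = a.lTensor F ∘ f.rTensor L := by
      ext x
      rw [← LinearMap.coe_comp, ← LinearMap.coe_comp, LinearMap.rTensor_comp_lTensor,
        LinearMap.lTensor_comp_rTensor]
    rw [← h1.of_comp_iff, this, h2.of_comp_iff]
  | succ n ih =>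
    obtain ⟨L', G', a', b', _, ha', hab', hb'⟩ := exists_free_cover (R := R) L
    rw [torVanishes_add_two_iff ha hab hb, torVanishes_add_two_iff ha' hab' hb', ih ha' hab' hb']

lemma torVanishes_comm (n : ℕ) : TorVanishes R (n + 1) M N ↔ TorVanishes R (n + 1) N M := by
  induction n generalizing M N with
  | zero => exact torVanishes_one_comm
  | succ n ih =>
    obtain ⟨K, F, f, g, _, hf, hfg, hg⟩ := exists_free_cover (R := R) N
    obtain ⟨L, G, a, b, _, ha, hab, hb⟩ := exists_free_cover (R := R) M
    rw [torVanishes_add_two_iff hf hfg hg, torVanishes_add_two_iff ha hab hb, ih,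
      torVanishes_syzygy_iff hf hfg hg ha hab hb]

lemma TorVanishes.of_shortExact {a : X →ₗ[R] Y} {b : Y →ₗ[R] Z}
    (ha : Function.Injective a) (hab : Function.Exact a b) (hb : Function.Surjective b) {n : ℕ}
    (hY : TorVanishes R (n + 1) Y N) (hZ : TorVanishes R (n + 2) Z N) :
    TorVanishes R (n + 1) X N := by
  induction n generalizing N with
  | zero =>
    obtain ⟨K, F, f, g, _, hf, hfg, hg⟩ := exists_free_cover (R := R) N
    obtain ⟨K', F', f', g', _, hf', hfg', hg'⟩ := exists_free_cover (R := R) K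
    rw [torVanishes_one_iff hf hfg hg] at hY ⊢
    rw [torVanishes_add_two_iff hf hfg hg, torVanishes_one_iff hf' hfg' hg'] at hZ
    have h := rTensor_injective_of_lTensor_injective ha hab hb hfg' hg' hZ
    have : f.lTensor Y ∘ a.rTensor K = a.rTensor F ∘ f.lTensor X := by
      ext x
      rw [← LinearMap.coe_comp, ← LinearMap.coe_comp, LinearMap.rTensor_comp_lTensor,
        LinearMap.lTensor_comp_rTensor]
    exact Function.Injective.of_comp (this ▸ hY.comp h)
  | succ n ih =>
    obtain ⟨K, F, f, g, _, hf, hfg, hg⟩ := exists_free_cover (R := R) N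
    rw [torVanishes_add_two_iff hf hfg hg] at hY hZ ⊢
    exact ih hY hZ

lemma torVanishes_of_flat [Module.Flat R M] (n : ℕ) : TorVanishes R (n + 1) M N := by
  induction n generalizing N with
  | zero =>
    obtain ⟨K, F, f, g, _, hf, hfg, hg⟩ := exists_free_cover (R := R) N
    exact (torVanishes_one_iff hf hfg hg).2 (Module.Flat.lTensor_preserves_injective_linearMap f hf)
  | succ n ih =>
    obtain ⟨K, F, f, g, _, hf, hfg, hg⟩ := exists_free_cover (R := R) N
    exact (torVanishes_add_two_iff hf hfg hg n).2 ih

lemma TorVanishes.prod {n : ℕ} (h : TorVanishes R (n + 1) M N) (h' : TorVanishes R (n + 1) L N) :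
    TorVanishes R (n + 1) (M × L) N := by
  induction n generalizing N with
  | zero =>
    obtain ⟨K, F, f, g, _, hf, hfg, hg⟩ := exists_free_cover (R := R) N
    rw [torVanishes_one_iff hf hfg hg] at h h' ⊢
    have : (TensorProduct.prodLeft R R M L F).toLinearMap ∘ₗ f.lTensor (M × L) =
        ((f.lTensor M).prodMap (f.lTensor L)) ∘ₗ (TensorProduct.prodLeft R R M L K).toLinearMap := by
      ext <;> simp
    have h2 : Function.Injective (((f.lTensor M).prodMap (f.lTensor L)) ∘ₗ
        (TensorProduct.prodLeft R R M L K).toLinearMap) :=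
      (h.prodMap h').comp (TensorProduct.prodLeft R R M L K).injective
    rw [← this, LinearMap.coe_comp] at h2
    exact Function.Injective.of_comp h2
  | succ n ih =>
    obtain ⟨K, F, f, g, _, hf, hfg, hg⟩ := exists_free_cover (R := R) N
    rw [torVanishes_add_two_iff hf hfg hg] at h h' ⊢
    exact ih h h'

end TorAlgebra

section BaseChange

open TensorProduct

lemma torPersistent_iff {R : Type u} [CommRing R] :
    TorPersistent R ↔ ∀ (M : Type u) [AddCommGroup M] [Module R M], Module.Finite R M →
      (∃ m : ℕ, ∀ i, m ≤ i → TorVanishes R (i + 1) M M) →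
        ∃ n, HasProjectiveDimensionLT (ModuleCat.of R M) (n + 1) := by
  constructor
  · rintro h M _ _ hM ⟨m, hm⟩
    obtain ⟨n, hn⟩ := (hasFiniteProjDim_iff _).1 (h (ModuleCat.of R M) hM
      ⟨m + 1, fun i hi => by
        obtain ⟨j, rfl⟩ : ∃ j, i = j + 1 := ⟨i - 1, by omega⟩
        exact hm j (by omega)⟩)
    exact ⟨n, hasProjectiveDimensionLT_of_ge _ n (n + 1) (by omega)⟩
  · rintro h M hM ⟨m, hm⟩
    obtain ⟨n, hn⟩ := h M hM ⟨m, fun i hi => hm (i + 1) (by omega)⟩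
    exact (hasFiniteProjDim_iff _).2 ⟨n + 1, hn⟩

section

variable {A : Type u} [CommRing A] {N K F : Type u} [AddCommGroup N] [Module A N]
  [AddCommGroup K] [Module A K] [AddCommGroup F] [Module A F]

lemma exists_finite_free_cover [IsNoetherianRing A] (N : Type u) [AddCommGroup N] [Module A N]
    [Module.Finite A N] :
    ∃ (K F : ModuleCat.{u} A) (f : K →ₗ[A] F) (g : F →ₗ[A] N), Module.Free A F ∧
      Module.Finite A K ∧ Module.Finite A F ∧
      Function.Injective f ∧ Function.Exact f g ∧ Function.Surjective g := by
  obtain ⟨P, _, _, _, _, g, hg⟩ := Module.exists_finite_presentation A N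
  exact ⟨ModuleCat.of A (LinearMap.ker g), ModuleCat.of A P, (LinearMap.ker g).subtype, g,
    inferInstanceAs (Module.Free A P), inferInstanceAs (Module.Finite A (LinearMap.ker g)),
    inferInstanceAs (Module.Finite A P), Subtype.val_injective, LinearMap.exact_subtype_ker_map g,
    hg⟩

lemma hasProjectiveDimensionLT_add_two_iff [Module.Projective A F] {f : K →ₗ[A] F}
    {g : F →ₗ[A] N} (hf : Function.Injective f) (hfg : Function.Exact f g)
    (hg : Function.Surjective g) (n : ℕ) :
    HasProjectiveDimensionLT (ModuleCat.of A N) (n + 2) ↔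
      HasProjectiveDimensionLT (ModuleCat.of A K) (n + 1) :=
  (shortExact_of_linearMap hf hfg hg).hasProjectiveDimensionLT_X₃_iff n
    ((IsProjective.iff_projective F).1 ‹_›)

end

section

variable {A : Type u} [CommRing A] (B : Type u) [CommRing B] [Algebra A B]
  {M N K F : Type u} [AddCommGroup M] [Module A M] [AddCommGroup N] [Module A N]
  [AddCommGroup K] [Module A K] [AddCommGroup F] [Module A F]

lemma lTensor_baseChange_injective_iff [Module.FaithfullyFlat A B] (f : K →ₗ[A] F) :
    Function.Injective ((f.baseChange B).lTensor (B ⊗[A] M)) ↔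
      Function.Injective (f.lTensor M) := by
  rw [← Module.FaithfullyFlat.lTensor_injective_iff_injective A B]
  have h : ((f.baseChange B).lTensor (B ⊗[A] M)) ∘ₗ
      (AlgebraTensorModule.distribBaseChange A B M K).toLinearMap =
      (AlgebraTensorModule.distribBaseChange A B M F).toLinearMap ∘ₗ
        (f.lTensor M).baseChange B := by
    ext
    simp
  have h' : ⇑((f.baseChange B).lTensor (B ⊗[A] M)) ∘
      (AlgebraTensorModule.distribBaseChange A B M K) =
      (AlgebraTensorModule.distribBaseChange A B M F) ∘ ((f.lTensor M).lTensor B) :=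
    congrArg DFunLike.coe h
  rw [← (AlgebraTensorModule.distribBaseChange A B M F).injective.of_comp_iff, ← h',
    Function.Injective.of_comp_iff']
  exact (AlgebraTensorModule.distribBaseChange A B M K).bijective

lemma torVanishes_baseChange_iff [Module.FaithfullyFlat A B] (n : ℕ) :
    TorVanishes B (n + 1) (B ⊗[A] M) (B ⊗[A] N) ↔ TorVanishes A (n + 1) M N := by
  induction n generalizing N with
  | zero =>
    obtain ⟨K, F, f, g, _, hf, hfg, hg⟩ := exists_free_cover (R := A) N
    rw [torVanishes_one_iff hf hfg hg, torVanishes_one_iff (f := f.baseChange B)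
      (g := g.baseChange B) (Module.Flat.lTensor_preserves_injective_linearMap f hf)
      (lTensor_exact B hfg hg) (LinearMap.lTensor_surjective B hg),
      lTensor_baseChange_injective_iff]
  | succ n ih =>
    obtain ⟨K, F, f, g, _, hf, hfg, hg⟩ := exists_free_cover (R := A) N
    rw [torVanishes_add_two_iff hf hfg hg, torVanishes_add_two_iff (f := f.baseChange B)
      (g := g.baseChange B) (Module.Flat.lTensor_preserves_injective_linearMap f hf)
      (lTensor_exact B hfg hg) (LinearMap.lTensor_surjective B hg), ih]

lemma hasProjectiveDimensionLT_baseChange_iff [IsNoetherianRing A] [IsNoetherianRing B]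
    [Module.FaithfullyFlat A B] [Module.Finite A N] (n : ℕ) :
    HasProjectiveDimensionLT (ModuleCat.of B (B ⊗[A] N)) (n + 1) ↔
      HasProjectiveDimensionLT (ModuleCat.of A N) (n + 1) := by
  induction n generalizing N with
  | zero =>
    rw [← projective_iff_hasProjectiveDimensionLT_one, ← projective_iff_hasProjectiveDimensionLT_one,
      ← IsProjective.iff_projective, ← IsProjective.iff_projective]
    constructor
    · intro h
      have : Module.Flat A N := Module.Flat.of_flat_tensorProduct A N B
      have : Module.FinitePresentation A N := Module.finitePresentation_of_finite A N
      exact Module.Flat.projective_of_finitePresentation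
    · intro h
      infer_instance
  | succ n ih =>
    obtain ⟨K, F, f, g, _, _, _, hf, hfg, hg⟩ := exists_finite_free_cover (A := A) N
    rw [hasProjectiveDimensionLT_add_two_iff hf hfg hg, hasProjectiveDimensionLT_add_two_iff
      (f := f.baseChange B) (g := g.baseChange B)
      (Module.Flat.lTensor_preserves_injective_linearMap f hf)
      (lTensor_exact B hfg hg) (LinearMap.lTensor_surjective B hg), ih]

variable (A) in
lemma TorPersistent.of_faithfullyFlat [IsNoetherianRing A] [IsNoetherianRing B]
    [Module.FaithfullyFlat A B] (h : TorPersistent B) : TorPersistent A := by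
  rw [torPersistent_iff] at h ⊢
  rintro M _ _ hM ⟨m, hm⟩
  obtain ⟨n, hn⟩ := h (B ⊗[A] M) inferInstance
    ⟨m, fun i hi => (torVanishes_baseChange_iff B i).2 (hm i hi)⟩
  exact ⟨n, (hasProjectiveDimensionLT_baseChange_iff B n).1 hn⟩

end

end BaseChange

section StepProjDim

open Abelian IsLocalRing

lemma hasProjectiveDimensionLT_of_exact_prod {B : Type u} [CommRing B] [IsLocalRing B]
    [IsNoetherianRing B] {M P E : Type u} [AddCommGroup M] [Module B M] [AddCommGroup P]
    [Module B P] [AddCommGroup E] [Module B E] [Module.Finite B M] {x : B}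
    (hx : x ∈ maximalIdeal B) {p : P →ₗ[B] M} {ι : E →ₗ[B] P × M} (hι : Function.Injective ι)
    (hex : Function.Exact ι (p.coprod (x • LinearMap.id)))
    (hsurj : Function.Surjective (p.coprod (x • LinearMap.id))) {n : ℕ}
    (h : HasProjectiveDimensionLT (ModuleCat.of B E) n) :
    HasProjectiveDimensionLT (ModuleCat.of B M) n := by
  have hS := shortExact_of_linearMap hι hex hsurj
  apply ModuleCat.hasProjectiveDimensionLT_of_forall_finite
  intro L _
  have zero := HasProjectiveDimensionLT.subsingleton (ModuleCat.of B E) n n le_rfl L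
  by_contra! ntr
  have : x ∈ (Module.annihilator B (Ext (ModuleCat.of B M) L n)).jacobson :=
    (IsLocalRing.maximalIdeal_le_jacobson _) hx
  absurd Submodule.top_ne_pointwise_smul_of_mem_jacobson_annihilator this
  rw [eq_comm, eq_top_iff]
  intro y hy
  obtain ⟨z, hz⟩ := Ext.contravariant_sequence_exact₂ hS L
    ((Ext.mk₀ (ModuleCat.ofHom (LinearMap.snd B P M))).comp y (zero_add n))
    (@Subsingleton.elim _ zero _ _)
  have h1 : ModuleCat.ofHom (LinearMap.inr B P M) ≫ ModuleCat.ofHom (LinearMap.snd B P M) =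
      𝟙 _ := rfl
  have h2 : ModuleCat.ofHom (LinearMap.inr B P M) ≫
      ModuleCat.ofHom (p.coprod (x • LinearMap.id)) = x • 𝟙 (ModuleCat.of B M) := by
    ext m
    simp
  have h3 := congrArg (fun e => (Ext.mk₀ (ModuleCat.ofHom (LinearMap.inr B P M))).comp e
    (zero_add n)) hz
  simp only [Ext.mk₀_comp_mk₀_assoc] at h3
  rw [h1, h2, Ext.mk₀_id_comp, Ext.mk₀_smul, Ext.smul_comp, Ext.mk₀_id_comp] at h3
  rw [← h3]
  exact Submodule.smul_mem_pointwise_smul _ _ ⊤ trivial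

end StepProjDim

section Step

open TensorProduct

variable {A : Type u} [CommRing A] {B : Type u} [CommRing B] [Algebra A B] {M : Type u}
  [AddCommGroup M] [Module A M] [Module B M] [IsScalarTower A B M] {n : ℕ}

/-- The kernel of `A^n × M → M`, `(f, m) ↦ ∑ f_i v_i + x m`. -/
abbrev perturbedKernel (x : A) (v : Fin n → M) : Submodule A ((Fin n → A) × M) :=
  LinearMap.ker ((Fintype.linearCombination A v).coprod (x • LinearMap.id))

/-- The comparison map from the base change of `perturbedKernel` to `B^n × M`. -/
noncomputable def perturbedKernelComparison (B : Type u) [CommRing B] [Algebra A B] [Module B M]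
    [IsScalarTower A B M] (x : A) (v : Fin n → M) :
    B ⊗[A] perturbedKernel x v →ₗ[B] (Fin n → B) × M :=
  LinearMap.liftBaseChange B
    ((((Algebra.linearMap A B).compLeft (Fin n)).prodMap LinearMap.id) ∘ₗ
      (perturbedKernel x v).subtype)

lemma perturbedKernelComparison_tmul (x : A) (v : Fin n → M) (b : B) (e : perturbedKernel x v) :
    perturbedKernelComparison B x v (b ⊗ₜ e) =
      (fun i => b * algebraMap A B (e.1.1 i), b • e.1.2) := by
  simp only [perturbedKernelComparison, LinearMap.liftBaseChange_tmul]
  rfl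

lemma finite_perturbedKernel [IsNoetherianRing A] [IsNoetherianRing B] [Module.Finite B M] {x : A}
    (hx : ∀ b : B, ∃ a b', b = algebraMap A B a + algebraMap A B x * b') (v : Fin n → M) :
    Module.Finite A (perturbedKernel x v) := by
  rw [Module.Finite.iff_fg]
  refine Submodule.fg_of_fg_map_of_fg_inf_ker (LinearMap.fst A (Fin n → A) M)
    (IsNoetherian.noetherian _) ?_
  let Z : Submodule B M := LinearMap.ker (algebraMap A B x • LinearMap.id)
  obtain ⟨S, hS⟩ : Z.FG := IsNoetherian.noetherian Z
  have hZ (z : M) : z ∈ Z ↔ x • z = 0 := by simp [Z]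
  have hle : ∀ z ∈ Z, z ∈ Submodule.span A (S : Set M) := by
    intro z hz
    have hz' := hz
    rw [← hS] at hz
    induction hz using Submodule.span_induction with
    | mem y hy => exact Submodule.subset_span hy
    | zero => exact Submodule.zero_mem _
    | add y w hy hw ihy ihw =>
      exact Submodule.add_mem _ (ihy (hS ▸ hy)) (ihw (hS ▸ hw))
    | smul b y hy ih =>
      have hyZ : y ∈ Z := hS ▸ hy
      obtain ⟨a, b', rfl⟩ := hx b
      have : (algebraMap A B a + algebraMap A B x * b') • y = a • y := by
        rw [add_smul, mul_comm, mul_smul, algebraMap_smul, algebraMap_smul, (hZ y).1 hyZ, smul_zero,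
          add_zero]
      rw [this]
      exact Submodule.smul_mem _ _ (ih hyZ)
  have : perturbedKernel x v ⊓ LinearMap.ker (LinearMap.fst A (Fin n → A) M) =
      (Submodule.span A (S : Set M)).map (LinearMap.inr A (Fin n → A) M) := by
    ext ⟨f, m⟩
    simp only [Submodule.mem_inf, LinearMap.mem_ker, LinearMap.coprod_apply, LinearMap.fst_apply,
      LinearMap.smul_apply, LinearMap.id_apply, Submodule.mem_map, LinearMap.inr_apply,
      Prod.mk.injEq]
    constructor
    · rintro ⟨h, rfl⟩
      rw [map_zero, zero_add] at h
      exact ⟨m, hle m ((hZ m).2 h), rfl, rfl⟩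
    · rintro ⟨y, hy, rfl, rfl⟩
      refine ⟨?_, rfl⟩
      have hyZ : y ∈ Z := hS ▸ (Submodule.span_le_restrictScalars A B (S : Set M) hy)
      rw [map_zero, zero_add, (hZ y).1 hyZ]
  rw [this]
  exact (Submodule.fg_span S.finite_toSet).map _

lemma exists_eq_one_tmul {x : A}
    (hx : ∀ b : B, ∃ a b', b = algebraMap A B a + algebraMap A B x * b') {Z : Type u}
    [AddCommGroup Z] [Module A Z] (hZ : ∀ z : Z, x • z = 0) (s : B ⊗[A] Z) :
    ∃ z, s = 1 ⊗ₜ z := by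
  induction s with
  | zero => exact ⟨0, by simp⟩
  | add s s' ih ih' =>
    obtain ⟨z, rfl⟩ := ih
    obtain ⟨z', rfl⟩ := ih'
    exact ⟨z + z', by rw [tmul_add]⟩
  | tmul b z =>
    obtain ⟨a, b', rfl⟩ := hx b
    refine ⟨a • z, ?_⟩
    rw [add_tmul, ← Algebra.smul_def, smul_tmul, hZ, tmul_zero, add_zero,
      Algebra.algebraMap_eq_smul_one, smul_tmul]

lemma injective_of_tmul_eq [Module.Flat A B] {x : A}
    (hx : ∀ b : B, ∃ a b', b = algebraMap A B a + algebraMap A B x * b') {E : Type u}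
    [AddCommGroup E] [Module A E] (q : E →ₗ[A] Fin n → A) (r : E →ₗ[A] M)
    (hq : ∀ e, q e = 0 → x • e = 0) (hqr : ∀ e, q e = 0 → r e = 0 → e = 0)
    (θ : B ⊗[A] E →ₗ[B] (Fin n → B) × M)
    (hθ : ∀ b e, θ (b ⊗ₜ e) = (fun i => b * algebraMap A B (q e i), b • r e)) :
    Function.Injective θ := by
  rw [injective_iff_map_eq_zero]
  intro t ht
  have hqθ : (piScalarRight A B B (Fin n)).toLinearMap ∘ₗ q.baseChange B =
      LinearMap.fst B (Fin n → B) M ∘ₗ θ := by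
    ext e i
    simp [hθ, Algebra.smul_def]
  have hqt : q.lTensor B t = 0 := by
    apply (piScalarRight A B B (Fin n)).injective
    rw [map_zero]
    exact (LinearMap.congr_fun hqθ t).trans (congrArg Prod.fst ht)
  have hker : Function.Exact ((LinearMap.ker q).subtype.lTensor B) (q.lTensor B) :=
    Module.Flat.lTensor_exact B (LinearMap.exact_subtype_ker_map q)
  obtain ⟨s, rfl⟩ := (hker t).1 hqt
  obtain ⟨z, rfl⟩ := exists_eq_one_tmul hx (fun z => Subtype.ext (hq z.1 z.2)) s
  rw [LinearMap.lTensor_tmul, hθ] at ht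
  have hz : (1 : B) • r z = 0 := congrArg Prod.snd ht
  rw [one_smul] at hz
  rw [LinearMap.lTensor_tmul, Submodule.subtype_apply, hqr z.1 z.2 hz, tmul_zero]

lemma injective_perturbedKernelComparison [Module.Flat A B] {x : A}
    (hx : ∀ b : B, ∃ a b', b = algebraMap A B a + algebraMap A B x * b') (v : Fin n → M) :
    Function.Injective (perturbedKernelComparison B x v) := by
  refine injective_of_tmul_eq hx
    (LinearMap.fst A (Fin n → A) M ∘ₗ (perturbedKernel x v).subtype)
    (LinearMap.snd A (Fin n → A) M ∘ₗ (perturbedKernel x v).subtype) ?_ ?_ _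
    (perturbedKernelComparison_tmul x v)
  · rintro ⟨⟨f, m⟩, h⟩ h'
    obtain rfl : f = 0 := h'
    ext
    · simp
    · simpa using h
  · rintro ⟨⟨f, m⟩, h⟩ h' h''
    exact Subtype.ext (Prod.ext h' h'')

lemma exact_perturbedKernelComparison {x : A}
    (hx : ∀ b : B, ∃ a b', b = algebraMap A B a + algebraMap A B x * b') (v : Fin n → M) :
    Function.Exact (perturbedKernelComparison B x v)
      ((Fintype.linearCombination B v).coprod (algebraMap A B x • LinearMap.id)) := by
  rw [LinearMap.exact_iff]
  apply le_antisymm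
  · rintro ⟨f, m⟩ hfm
    choose a b hab using fun i => hx (f i)
    let e (j : Fin n) : perturbedKernel x v := ⟨(Pi.single j x, - v j), by
      rw [LinearMap.mem_ker, LinearMap.coprod_apply, Fintype.linearCombination_apply_single]
      simp⟩
    let w : perturbedKernel x v := ⟨(a, m + Fintype.linearCombination B v b), by
      rw [LinearMap.mem_ker, LinearMap.coprod_apply] at hfm ⊢
      rw [← hfm]
      simp only [Fintype.linearCombination_apply, LinearMap.smul_apply, LinearMap.id_apply,
        smul_add, Finset.smul_sum]
      rw [add_comm (x • m), ← add_assoc, ← Finset.sum_add_distrib, algebraMap_smul]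
      congr 1
      refine Finset.sum_congr rfl fun i _ => ?_
      conv_rhs => rw [hab i]
      rw [add_smul, mul_smul, algebraMap_smul, algebraMap_smul]⟩
    refine ⟨1 ⊗ₜ w + ∑ j, b j ⊗ₜ e j, ?_⟩
    rw [map_add, map_sum]
    simp only [perturbedKernelComparison_tmul, w, e]
    ext i
    · simp only [Prod.fst_add, Prod.fst_sum, Pi.add_apply, Finset.sum_apply]
      rw [Finset.sum_eq_single i]
      · simp only [Pi.single_eq_same, one_mul]
        rw [mul_comm (b i), ← hab i]
      · intro j _ hj
        rw [Pi.single_eq_of_ne hj.symm, map_zero, mul_zero]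
      · simp
    · simp [Fintype.linearCombination_apply, Prod.snd_sum]
  · rintro _ ⟨t, rfl⟩
    rw [LinearMap.mem_ker]
    induction t with
    | zero => simp
    | add s t hs ht => rw [map_add, map_add, hs, ht, add_zero]
    | tmul b e =>
      have he := e.2
      rw [LinearMap.mem_ker, LinearMap.coprod_apply, Fintype.linearCombination_apply] at he
      rw [perturbedKernelComparison_tmul, LinearMap.coprod_apply, Fintype.linearCombination_apply]
      have := congrArg (b • ·) he
      simp only [smul_add, Finset.smul_sum, smul_zero] at this
      rw [← this]
      congr 1
      · refine Finset.sum_congr rfl fun i _ => ?_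
        rw [mul_smul, algebraMap_smul]
      · simp only [LinearMap.smul_apply, LinearMap.id_apply]
        rw [algebraMap_smul, smul_comm]

end Step

section StepTor

open IsLocalRing

lemma torVanishes_self_of_exact_prod {B : Type u} [CommRing B] {M P E : Type u} [AddCommGroup M]
    [Module B M] [AddCommGroup P] [Module B P] [AddCommGroup E] [Module B E] [Module.Flat B P]
    {ι : E →ₗ[B] P × M} {p : P × M →ₗ[B] M} (hι : Function.Injective ι)
    (hex : Function.Exact ι p) (hp : Function.Surjective p) {m : ℕ}
    (h : ∀ i, m ≤ i → TorVanishes B (i + 1) M M) (i : ℕ) (hi : m ≤ i) :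
    TorVanishes B (i + 1) E E := by
  have hEM (j : ℕ) (hj : m ≤ j) : TorVanishes B (j + 1) E M :=
    .of_shortExact hι hex hp (.prod (torVanishes_of_flat j) (h j hj)) (h (j + 1) (by omega))
  have hME (j : ℕ) (hj : m ≤ j) : TorVanishes B (j + 1) M E :=
    (torVanishes_comm j).1 (hEM j hj)
  exact .of_shortExact hι hex hp (.prod (torVanishes_of_flat i) (hME i hi))
    (hME (i + 1) (by omega))

lemma TorPersistent.of_forall_eq_add_mul {A B : Type u} [CommRing A] [CommRing B] [Algebra A B]
    [IsNoetherianRing A] [IsNoetherianRing B] [IsLocalRing B]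
    [Module.FaithfullyFlat A B] {x : A} (hxB : algebraMap A B x ∈ maximalIdeal B)
    (hx : ∀ b : B, ∃ a b', b = algebraMap A B a + algebraMap A B x * b')
    (h : TorPersistent A) : TorPersistent B := by
  rw [torPersistent_iff] at h ⊢
  rintro M _ _ hM ⟨m, hm⟩
  let _ : Module A M := Module.compHom M (algebraMap A B)
  have : IsScalarTower A B M := IsScalarTower.of_compHom A B M
  obtain ⟨n, v, hv⟩ := Module.Finite.exists_fin (R := B) (M := M)
  have hsurj : Function.Surjective
      ((Fintype.linearCombination B v).coprod (algebraMap A B x • LinearMap.id)) := by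
    intro y
    obtain ⟨f, hf⟩ : y ∈ LinearMap.range (Fintype.linearCombination B v) := by
      rw [Fintype.range_linearCombination, hv]
      trivial
    exact ⟨(f, 0), by rw [LinearMap.coprod_apply, hf, map_zero, add_zero]⟩
  have hinj := injective_perturbedKernelComparison hx v
  have hex := exact_perturbedKernelComparison hx v
  have hfin := finite_perturbedKernel hx v
  obtain ⟨k, hk⟩ := h (perturbedKernel x v) hfin ⟨m, fun i hi =>
    (torVanishes_baseChange_iff B i).1 (torVanishes_self_of_exact_prod hinj hex hsurj hm i hi)⟩
  exact ⟨k, hasProjectiveDimensionLT_of_exact_prod hxB hinj hex hsurj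
    ((hasProjectiveDimensionLT_baseChange_iff B k).2 hk)⟩

end StepTor

section Precomplete

open Finset

section

variable {A : Type*} [CommRing A]

lemma IsPrecomplete.exists_sub_sum_mem {I : Ideal A} (h : IsPrecomplete I A) (u : ℕ → A)
    (hu : ∀ k, u k ∈ I ^ k) : ∃ c, ∀ n, c - ∑ k ∈ range n, u k ∈ I ^ n := by
  obtain ⟨L, hL⟩ := h.prec (f := fun n => ∑ k ∈ range n, u k) (by
    intro m n hmn
    rw [SModEq.comm, SModEq.sub_mem, smul_eq_mul, Ideal.mul_top, ← sum_Ico_eq_sub _ hmn]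
    exact Ideal.sum_mem _ fun k hk => Ideal.pow_le_pow_right (mem_Ico.1 hk).1 (hu k))
  refine ⟨L, fun n => ?_⟩
  have := (hL n).symm
  rwa [SModEq.sub_mem, smul_eq_mul, Ideal.mul_top] at this

lemma IsPrecomplete.of_exists_sub_sum_mem {I : Ideal A}
    (h : ∀ u : ℕ → A, (∀ k, u k ∈ I ^ k) → ∃ c, ∀ n, c - ∑ k ∈ range n, u k ∈ I ^ n) :
    IsPrecomplete I A := by
  refine ⟨fun f hf => ?_⟩
  obtain ⟨c, hc⟩ := h (fun k => f (k + 1) - f k) fun k => by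
    have := (hf (Nat.le_succ k)).symm
    rwa [SModEq.sub_mem, smul_eq_mul, Ideal.mul_top] at this
  refine ⟨c + f 0, fun n => ?_⟩
  have := hc n
  rw [sum_range_sub] at this
  rw [SModEq.comm, SModEq.sub_mem, smul_eq_mul, Ideal.mul_top]
  convert this using 1
  ring

lemma IsPrecomplete.sup {I J : Ideal A} (hI : IsPrecomplete I A) (hJ : IsPrecomplete J A) :
    IsPrecomplete (I ⊔ J) A := by
  refine .of_exists_sub_sum_mem fun u hu => ?_
  have huu (k : ℕ) : ∃ v ∈ I ^ k, ∃ w ∈ J ^ k, v + w = u (2 * k) + u (2 * k + 1) := by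
    refine Submodule.mem_sup.1 (Ideal.sup_pow_add_le_pow_sup_pow (Ideal.add_mem _ ?_ ?_))
    · rw [← two_mul]
      exact hu _
    · rw [← two_mul]
      exact Ideal.pow_le_pow_right (Nat.le_succ _) (hu _)
  choose v hv w hw hvw using huu
  obtain ⟨V, hV⟩ := hI.exists_sub_sum_mem v hv
  obtain ⟨W, hW⟩ := hJ.exists_sub_sum_mem w hw
  have hsum (n : ℕ) : ∑ k ∈ range (2 * n), u k = ∑ k ∈ range n, v k + ∑ k ∈ range n, w k := by
    induction n with
    | zero => simp
    | succ n ih =>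
      rw [mul_add, mul_one, sum_range_succ, sum_range_succ, ih, sum_range_succ, sum_range_succ,
        add_assoc, ← hvw]
      ring
  refine ⟨V + W, fun n => ?_⟩
  have h1 : V + W - ∑ k ∈ range n, u k = (V - ∑ k ∈ range n, v k) + (W - ∑ k ∈ range n, w k) +
      ∑ k ∈ Ico n (2 * n), u k := by
    rw [sum_Ico_eq_sub _ (by omega : n ≤ 2 * n), hsum]
    ring
  rw [h1]
  refine Ideal.add_mem _ (Ideal.add_mem _ ?_ ?_) (Ideal.sum_mem _ fun k hk => ?_)
  · exact Ideal.pow_right_mono le_sup_left n (hV n)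
  · exact Ideal.pow_right_mono le_sup_right n (hW n)
  · exact Ideal.pow_le_pow_right (mem_Ico.1 hk).1 (hu k)

lemma isPrecomplete_span_singleton_iff {y : A} :
    IsPrecomplete (Ideal.span {y}) A ↔
      ∀ b : ℕ → A, ∃ c, ∀ n, y ^ n ∣ c - ∑ k ∈ range n, y ^ k * b k := by
  constructor
  · intro h b
    obtain ⟨c, hc⟩ := h.exists_sub_sum_mem (fun k => y ^ k * b k) fun k => by
      rw [Ideal.span_singleton_pow, Ideal.mem_span_singleton]
      exact dvd_mul_right _ _
    refine ⟨c, fun n => ?_⟩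
    rw [← Ideal.mem_span_singleton, ← Ideal.span_singleton_pow]
    exact hc n
  · intro h
    refine .of_exists_sub_sum_mem fun u hu => ?_
    simp only [Ideal.span_singleton_pow, Ideal.mem_span_singleton] at hu ⊢
    choose b hb using hu
    obtain ⟨c, hc⟩ := h b
    refine ⟨c, fun n => ?_⟩
    simpa only [hb] using hc n

lemma dvd_of_forall_exists_eq_add [IsNoetherianRing A] {x c z : A}
    (hx : x ∈ Ideal.jacobson (⊥ : Ideal A)) (h : ∀ n : ℕ, ∃ s t, c = z * s + x ^ n * t) :
    z ∣ c := by
  have : IsHausdorff (Ideal.span {x}) (A ⧸ Ideal.span {z}) :=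
    .of_le_jacobson _ _ ((Ideal.span_singleton_le_iff_mem _).2 hx)
  rw [← Ideal.mem_span_singleton, ← Ideal.Quotient.eq_zero_iff_mem]
  refine this.haus _ fun n => ?_
  rw [SModEq.zero]
  obtain ⟨s, t, hst⟩ := h n
  have : Ideal.Quotient.mk (Ideal.span {z}) c = x ^ n • Ideal.Quotient.mk (Ideal.span {z}) t := by
    rw [hst, map_add, Algebra.smul_def, map_mul, map_mul]
    rw [Ideal.Quotient.eq_zero_iff_mem.2 (Ideal.mem_span_singleton_self z), zero_mul, zero_add]
    rfl
  rw [this]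
  refine Submodule.smul_mem_smul ?_ trivial
  rw [Ideal.span_singleton_pow]
  exact Ideal.mem_span_singleton_self _

end

/-- Precompleteness along `y` passes to the completion along another element `x`. -/
lemma IsPrecomplete.map_of_forall_eq_add_mul {A B : Type*} [CommRing A] [CommRing B] [Algebra A B]
    [IsNoetherianRing B] {x : B} (hxB : x ∈ Ideal.jacobson (⊥ : Ideal B))
    (hx : ∀ b : B, ∃ a b', b = algebraMap A B a + x * b')
    (hB : IsPrecomplete (Ideal.span {x}) B) {y : A} (hA : IsPrecomplete (Ideal.span {y}) A) :
    IsPrecomplete (Ideal.span {algebraMap A B y}) B := by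
  rw [isPrecomplete_span_singleton_iff] at hA hB ⊢
  intro b
  choose α β hαβ using hx
  let rem (i k : ℕ) : B := β^[k] (b i)
  let coeff (i k : ℕ) : A := α (rem i k)
  have hb (i k : ℕ) : b i = ∑ j ∈ range k, x ^ j * algebraMap A B (coeff i j) + x ^ k * rem i k := by
    induction k with
    | zero => simp [rem]
    | succ k ih =>
      have h1 : rem i k = algebraMap A B (coeff i k) + x * rem i (k + 1) := by
        simp only [coeff, rem, Function.iterate_succ_apply']
        exact hαβ _
      rw [sum_range_succ, ih, h1]
      ring
  choose e he using fun k => hA fun i => coeff i k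
  obtain ⟨c, hc⟩ := hB fun k => algebraMap A B (e k)
  refine ⟨c, fun n => dvd_of_forall_exists_eq_add hxB fun K => ?_⟩
  choose r hr using fun k => he k n
  obtain ⟨t, ht⟩ := hc K
  refine ⟨∑ k ∈ range K, x ^ k * algebraMap A B (r k),
    t - ∑ i ∈ range n, algebraMap A B y ^ i * rem i K, ?_⟩
  have hc' : c = ∑ k ∈ range K, x ^ k * algebraMap A B (e k) + x ^ K * t := by
    rw [← ht]
    ring
  have he' (k : ℕ) : e k = ∑ i ∈ range n, y ^ i * coeff i k + y ^ n * r k := by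
    rw [← hr k]
    ring
  have h1 : ∑ i ∈ range n, algebraMap A B y ^ i * b i =
      ∑ i ∈ range n, algebraMap A B y ^ i * ∑ j ∈ range K, x ^ j * algebraMap A B (coeff i j) +
        x ^ K * ∑ i ∈ range n, algebraMap A B y ^ i * rem i K := by
    rw [mul_sum, ← sum_add_distrib]
    refine sum_congr rfl fun i _ => ?_
    rw [hb i K]
    ring
  have h2 : ∑ k ∈ range K, x ^ k * algebraMap A B (e k) =
      ∑ i ∈ range n, algebraMap A B y ^ i * ∑ j ∈ range K, x ^ j * algebraMap A B (coeff i j) +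
        algebraMap A B y ^ n * ∑ k ∈ range K, x ^ k * algebraMap A B (r k) := by
    simp only [mul_sum]
    rw [sum_comm, ← sum_add_distrib]
    refine sum_congr rfl fun k _ => ?_
    rw [he' k, map_add, map_sum, mul_add, mul_sum]
    simp only [map_mul, map_pow]
    congr 1
    · exact sum_congr rfl fun i _ => by ring
    · ring
  rw [hc', h1, h2]
  ring

/-- A ring which is complete along `x` is noetherian if its quotient by `x` is. -/
lemma isNoetherianRing_of_isAdicComplete_span_singleton {B : Type*} [CommRing B] {x : B}
    [hB : IsAdicComplete (Ideal.span {x}) B] [IsNoetherianRing (B ⧸ Ideal.span {x})] :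
    IsNoetherianRing B := by
  refine IsNoetherianRing.of_prime fun P hP => ?_
  have hmap : (P.map (Ideal.Quotient.mk (Ideal.span {x}))).FG := IsNoetherian.noetherian _
  by_cases hx : x ∈ P
  · refine Ideal.fg_of_fg_map_of_fg_inf_ker_of_surjective hmap ?_ Ideal.Quotient.mk_surjective
    rw [Ideal.mk_ker, inf_eq_right.2 ((Ideal.span_singleton_le_iff_mem _).2 hx)]
    exact ⟨{x}, by simp⟩
  obtain ⟨r, v, hv⟩ := Submodule.fg_iff_exists_fin_generating_family.1 hmap
  have hlift (i : Fin r) : ∃ p ∈ P, Ideal.Quotient.mk (Ideal.span {x}) p = v i :=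
    (Ideal.mem_map_iff_of_surjective _ Ideal.Quotient.mk_surjective).1
      (hv ▸ Submodule.subset_span ⟨i, rfl⟩)
  choose p hpP hpv using hlift
  have hstep (z : P) : ∃ (a : Fin r → B) (z' : P), z.1 = ∑ i, a i * p i + x * z' := by
    have hz : Ideal.Quotient.mk (Ideal.span {x}) z.1 ∈ Submodule.span _ (Set.range v) :=
      hv ▸ Ideal.mem_map_of_mem _ z.2
    obtain ⟨a, ha⟩ := (Submodule.mem_span_range_iff_exists_fun _).1 hz
    choose a' ha' using fun i => Ideal.Quotient.mk_surjective (a i)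
    have h0 : Ideal.Quotient.mk (Ideal.span {x}) (z.1 - ∑ i, a' i * p i) = 0 := by
      rw [map_sub, map_sum, ← ha, sub_eq_zero]
      simp only [map_mul, ha', hpv, smul_eq_mul]
    obtain ⟨w, hw⟩ := Ideal.mem_span_singleton.1 (Ideal.Quotient.eq_zero_iff_mem.1 h0)
    have hxw : x * w ∈ P := by
      rw [← hw]
      exact Ideal.sub_mem _ z.2 (Ideal.sum_mem _ fun i _ => Ideal.mul_mem_left _ _ (hpP i))
    exact ⟨a', ⟨w, (hP.mem_or_mem hxw).resolve_left hx⟩, by rw [← hw]; ring⟩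
  choose α β hαβ using hstep
  refine Submodule.fg_iff_exists_fin_generating_family.2 ⟨r, p, ?_⟩
  apply le_antisymm (Submodule.span_le.2 (Set.range_subset_iff.2 hpP))
  intro z hz
  let rem (k : ℕ) : P := β^[k] ⟨z, hz⟩
  have hsum (k : ℕ) : z = ∑ i, (∑ j ∈ range k, x ^ j * α (rem j) i) * p i + x ^ k * rem k := by
    induction k with
    | zero => simp [rem]
    | succ k ih =>
      have h1 : (rem k).1 = ∑ i, α (rem k) i * p i + x * rem (k + 1) := by
        simp only [rem, Function.iterate_succ_apply']
        exact hαβ _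
      conv_lhs => rw [ih, h1]
      simp only [sum_range_succ, add_mul, sum_add_distrib, mul_add, mul_sum, pow_succ, mul_assoc,
        add_assoc]
  choose c hc using fun i =>
    isPrecomplete_span_singleton_iff.1 hB.toIsPrecomplete fun j => α (rem j) i
  rw [Submodule.mem_span_range_iff_exists_fun]
  refine ⟨c, ?_⟩
  simp only [smul_eq_mul]
  rw [← sub_eq_zero]
  refine hB.toIsHausdorff.haus _ fun n => ?_
  rw [SModEq.zero, smul_eq_mul, Ideal.mul_top, Ideal.span_singleton_pow, Ideal.mem_span_singleton]
  have h2 : ∑ i, c i * p i - z =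
      ∑ i, (c i - ∑ j ∈ range n, x ^ j * α (rem j) i) * p i - x ^ n * rem n := by
    conv_lhs => rw [hsum n]
    simp only [sub_mul, sum_sub_distrib]
    ring
  rw [h2]
  exact dvd_sub (dvd_sum fun i _ => (hc i n).mul_right _) (dvd_mul_right _ _)

end Precomplete

section AdicCompletion

open IsLocalRing

/-- Completing a noetherian local ring along one element of its maximal ideal. -/
theorem exists_faithfullyFlat_isPrecomplete_span_singleton {A : Type u} [CommRing A]
    [IsNoetherianRing A] [IsLocalRing A] {x : A} (hx : x ∈ maximalIdeal A) :
    ∃ (B : Type u) (_ : CommRing B) (_ : Algebra A B),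
      IsNoetherianRing B ∧ IsLocalRing B ∧ Module.FaithfullyFlat A B ∧
      algebraMap A B x ∈ Ideal.jacobson (⊥ : Ideal B) ∧
      IsPrecomplete (Ideal.span {algebraMap A B x}) B ∧
      ∀ b : B, ∃ a b', b = algebraMap A B a + algebraMap A B x * b' := by
  let I : Ideal A := Ideal.span {x}
  have hfg : I.FG := ⟨{x}, by simp [I]⟩
  let B := AdicCompletion I A
  have hmap : I.map (algebraMap A B) = Ideal.span {algebraMap A B x} := by
    simp [I, Ideal.map_span]
  have hcomp : IsAdicComplete (Ideal.span {algebraMap A B x}) B :=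
    hmap ▸ AdicCompletion.isAdicComplete_self I hfg
  have hjac : algebraMap A B x ∈ Ideal.jacobson (⊥ : Ideal B) :=
    IsAdicComplete.le_jacobson_bot _ (Ideal.mem_span_singleton_self _)
  have hI : I ≤ maximalIdeal A := by simpa [I, Ideal.span_le] using hx
  have hdec : ∀ b : B, ∃ a b', b = algebraMap A B a + algebraMap A B x * b' := by
    intro b
    obtain ⟨a, ha⟩ := Ideal.Quotient.mk_surjective (AdicCompletion.evalOneₐ I b)
    have hker : b - algebraMap A B a ∈ RingHom.ker (AdicCompletion.evalOneₐ I) := by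
      rw [RingHom.mem_ker, map_sub, AlgHom.commutes, ← ha, sub_eq_zero]
      rfl
    have : b - algebraMap A B a ∈ Ideal.span {algebraMap A B x} := by
      rw [← hmap, ← AdicCompletion.ker_evalOneₐ_eq_map I hfg]
      exact hker
    obtain ⟨b', hb'⟩ := Ideal.mem_span_singleton.1 this
    exact ⟨a, b', by rw [← hb']; ring⟩
  have hsurj : Function.Surjective
      ((Ideal.Quotient.mk (Ideal.span {algebraMap A B x})).comp (algebraMap A B)) := by
    intro q
    obtain ⟨b, rfl⟩ := Ideal.Quotient.mk_surjective q
    obtain ⟨a, b', rfl⟩ := hdec b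
    refine ⟨a, Ideal.Quotient.eq.2 (Ideal.mem_span_singleton.2 ⟨-b', by ring⟩)⟩
  have : IsNoetherianRing (B ⧸ Ideal.span {algebraMap A B x}) :=
    isNoetherianRing_of_surjective _ _ _ hsurj
  have hnoeth : IsNoetherianRing B := isNoetherianRing_of_isAdicComplete_span_singleton (x := algebraMap A B x)
  have hmax : ((maximalIdeal A).map (algebraMap A B)).IsMaximal :=
    AdicCompletion.isMaximal_map_of_le I _ hI hfg
  have hunit : ∀ a : A, IsUnit (algebraMap A B a) → IsUnit a := by
    intro a ha
    by_contra hna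
    exact hmax.ne_top (Ideal.eq_top_of_isUnit_mem _
      (Ideal.mem_map_of_mem _ ((mem_maximalIdeal a).2 hna)) ha)
  have hadd : ∀ a b' : B, IsUnit a → IsUnit (a + algebraMap A B x * b') := by
    rintro _ b' ⟨a, rfl⟩
    have := (Ideal.mem_jacobson_bot.1 hjac) (b' * ↑a⁻¹)
    have h2 : (a : B) + algebraMap A B x * b' =
        a * (algebraMap A B x * (b' * ↑a⁻¹) + 1) := by
      calc (a : B) + algebraMap A B x * b'
          = a + (a * ↑a⁻¹) * (algebraMap A B x * b') := by simp
        _ = _ := by ring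
    rw [h2]
    exact a.isUnit.mul this
  have : Nontrivial B := Submodule.nontrivial_iff B |>.1 ⟨_, _, hmax.ne_top⟩
  have hloc : IsLocalRing B := by
    refine IsLocalRing.of_isUnit_or_isUnit_one_sub_self fun b => ?_
    obtain ⟨a, b', rfl⟩ := hdec b
    rcases IsLocalRing.isUnit_or_isUnit_one_sub_self a with h | h
    · exact .inl (hadd _ _ (h.map _))
    · right
      have := hadd _ (-b') (h.map (algebraMap A B))
      rw [map_sub, map_one] at this
      convert this using 1
      ring
  have : IsLocalHom (algebraMap A B) := ⟨hunit⟩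
  have : Module.Flat A B := AdicCompletion.flat_of_isNoetherian I
  exact ⟨B, inferInstance, inferInstance, hnoeth, hloc,
    Module.FaithfullyFlat.of_flat_of_isLocalHom, hjac, hcomp.toIsPrecomplete, hdec⟩

/-- Completing a noetherian local ring along finitely many elements of its maximal ideal,
one element at a time. -/
theorem exists_faithfullyFlat_isPrecomplete_of_list {R : Type u} [CommRing R]
    [IsNoetherianRing R] [IsLocalRing R] (l : List R) (hl : ∀ x ∈ l, x ∈ maximalIdeal R) :
    ∃ (S : Type u) (_ : CommRing S) (_ : Algebra R S),
      IsNoetherianRing S ∧ IsLocalRing S ∧ Module.FaithfullyFlat R S ∧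
      (∀ x ∈ l, IsPrecomplete (Ideal.span {algebraMap R S x}) S) ∧
      (∀ s : S, ∃ r : R, s - algebraMap R S r ∈ (maximalIdeal R).map (algebraMap R S)) ∧
      (TorPersistent R → TorPersistent S) := by
  induction l with
  | nil =>
    refine ⟨R, inferInstance, inferInstance, inferInstance, inferInstance, inferInstance,
      by simp, fun s => ⟨s, by simp⟩, id⟩
  | cons x l ih =>
    obtain ⟨S, _, _, _, _, _, hpre, hdec, htor⟩ := ih fun y hy => hl y (List.mem_cons_of_mem _ hy)
    have hloc : IsLocalHom (algebraMap R S) := by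
      refine ⟨fun a ha => ?_⟩
      by_contra hna
      have h1 := Ideal.comap_map_eq_self_of_faithfullyFlat (A := R) (B := S) (maximalIdeal R)
      have h2 : (maximalIdeal R).map (algebraMap R S) = ⊤ := Ideal.eq_top_of_isUnit_mem _
        (Ideal.mem_map_of_mem _ ((mem_maximalIdeal a).2 hna)) ha
      rw [h2, Ideal.comap_top] at h1
      exact (maximalIdeal.isMaximal R).ne_top h1.symm
    have hx : x ∈ maximalIdeal R := hl x List.mem_cons_self
    have hxS : algebraMap R S x ∈ maximalIdeal S := by
      rw [mem_maximalIdeal, mem_nonunits_iff, isUnit_map_iff]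
      exact hx
    obtain ⟨T, _, _, _, _, _, hjac, hpreT, hdecT⟩ :=
      exists_faithfullyFlat_isPrecomplete_span_singleton hxS
    let _ : Algebra R T := Algebra.compHom T (algebraMap R S)
    have : IsScalarTower R S T := .of_algebraMap_eq fun _ => rfl
    refine ⟨T, inferInstance, inferInstance, inferInstance, inferInstance,
      Module.FaithfullyFlat.trans R S T, ?_, ?_, ?_⟩
    · intro y hy
      rw [IsScalarTower.algebraMap_apply R S T]
      rcases List.mem_cons.1 hy with rfl | hy
      · exact hpreT
      · exact IsPrecomplete.map_of_forall_eq_add_mul hjac hdecT hpreT (hpre y hy)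
    · intro t
      obtain ⟨s, t', rfl⟩ := hdecT t
      obtain ⟨r, hr⟩ := hdec s
      refine ⟨r, ?_⟩
      have h1 := Ideal.mem_map_of_mem (algebraMap S T) hr
      rw [Ideal.map_map, ← IsScalarTower.algebraMap_eq, map_sub,
        ← IsScalarTower.algebraMap_apply] at h1
      have h2 := Ideal.mul_mem_right t' _ (Ideal.mem_map_of_mem (algebraMap R T) hx)
      rw [IsScalarTower.algebraMap_apply R S T] at h2
      convert add_mem h1 h2 using 1
      ring
    · intro h
      exact (htor h).of_forall_eq_add_mul
        (IsLocalRing.jacobson_eq_maximalIdeal (⊥ : Ideal T) bot_ne_top ▸ hjac) hdecT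

theorem exists_pow_sub_mem_map {R S : Type*} [CommRing R] [CommRing S] [Algebra R S]
    {I : Ideal R} (h : ∀ s : S, ∃ r : R, s - algebraMap R S r ∈ I.map (algebraMap R S))
    (n : ℕ) (s : S) : ∃ r : R, s - algebraMap R S r ∈ I.map (algebraMap R S) ^ n := by
  induction n generalizing s with
  | zero => exact ⟨0, by simp⟩
  | succ n ih =>
    have key : ∀ t ∈ (I ^ n).map (algebraMap R S), ∀ c : S, ∃ r : R,
        c * t - algebraMap R S r ∈ I.map (algebraMap R S) ^ (n + 1) := by
      intro t ht
      rw [Ideal.map] at ht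
      refine Submodule.span_induction ?_ (fun _ => ⟨0, by simp⟩) ?_ ?_ ht
      · rintro _ ⟨a, ha, rfl⟩ c
        obtain ⟨r, hr⟩ := h c
        refine ⟨r * a, ?_⟩
        rw [map_mul, ← sub_mul, pow_succ', ← Ideal.map_pow]
        exact Ideal.mul_mem_mul hr (Ideal.mem_map_of_mem _ ha)
      · intro t t' _ _ ht ht' c
        obtain ⟨r, hr⟩ := ht c
        obtain ⟨r', hr'⟩ := ht' c
        refine ⟨r + r', ?_⟩
        convert add_mem hr hr' using 1
        rw [map_add]
        ring
      · intro d t _ ht c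
        simpa only [smul_eq_mul, mul_assoc] using ht (c * d)
    obtain ⟨r, hr⟩ := ih s
    rw [← Ideal.map_pow] at hr
    obtain ⟨r', hr'⟩ := key _ hr 1
    exact ⟨r + r', by rwa [map_add, ← sub_sub, ← one_mul (s - _)]⟩

/-- A complete faithfully flat extension with the same residue ring is the adic completion. -/
theorem exists_algEquiv_adicCompletion {R S : Type*} [CommRing R] [CommRing S] [Algebra R S]
    [Module.FaithfullyFlat R S] (I : Ideal R) [IsAdicComplete (I.map (algebraMap R S)) S]
    (h : ∀ s : S, ∃ r : R, s - algebraMap R S r ∈ I.map (algebraMap R S)) :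
    Nonempty (AdicCompletion I R ≃ₐ[R] S) := by
  let J := I.map (algebraMap R S)
  have hcomap : ∀ n, (J ^ n).comap (algebraMap R S) = I ^ n := fun n => by
    rw [← Ideal.map_pow, Ideal.comap_map_eq_self_of_faithfullyFlat]
  let g (n : ℕ) : R ⧸ I ^ n →ₐ[R] S ⧸ J ^ n :=
    Ideal.quotientMapₐ (J ^ n) (Algebra.ofId R S) (hcomap n).ge
  have hg (n : ℕ) (r : R) : g n (Ideal.Quotient.mk _ r) =
    Ideal.Quotient.mk _ (algebraMap R S r) := rfl
  have hginj (n : ℕ) : Function.Injective (g n) :=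
    Ideal.quotientMap_injective' (H := (hcomap n).ge) (hcomap n).le
  let f (n : ℕ) : AdicCompletion I R →ₐ[R] S ⧸ J ^ n := (g n).comp (AdicCompletion.evalₐ I n)
  have hf {m n : ℕ} (hle : m ≤ n) :
      (Ideal.Quotient.factorₐ R (Ideal.pow_le_pow_right hle)).comp (f n) = f m := by
    ext x
    obtain ⟨x, rfl⟩ := AdicCompletion.mk_surjective I R x
    have hx : x m - x n ∈ I ^ m := by
      simpa [SModEq.sub_mem] using x.2 hle
    have hx' := Ideal.mem_map_of_mem (algebraMap R S) hx
    rw [Ideal.map_pow, map_sub] at hx'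
    simp only [f, AlgHom.comp_apply, AdicCompletion.evalₐ_mk]
    exact ((Ideal.Quotient.eq (I := J ^ m)).2 hx').symm
  let φ : AdicCompletion I R →ₐ[R] S := IsAdicComplete.liftAlgHom J f hf
  have hφ (n : ℕ) (x) : Ideal.Quotient.mk (J ^ n) (φ x) = g n (AdicCompletion.evalₐ I n x) :=
    IsAdicComplete.mk_liftAlgHom J f hf n x
  refine ⟨AlgEquiv.ofBijective φ ⟨?_, ?_⟩⟩
  · intro x y hxy
    refine AdicCompletion.ext_evalₐ fun n => hginj n ?_
    rw [← hφ, ← hφ, hxy]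
  · intro s
    choose r hr using fun n => exists_pow_sub_mem_map h n s
    have hgr (n : ℕ) : g n (Ideal.Quotient.mk _ (r n)) = Ideal.Quotient.mk _ s :=
      ((Ideal.Quotient.eq (I := J ^ n)).2 (hr n)).symm
    have hcauchy (n : ℕ) : r n ≡ r (n + 1) [SMOD (I ^ n • ⊤ : Submodule R R)] := by
      rw [SModEq.sub_mem, smul_eq_mul, Ideal.mul_top, ← hcomap, Ideal.mem_comap, map_sub]
      convert sub_mem (Ideal.pow_le_pow_right n.le_succ (hr (n + 1))) (hr n) using 1
      ring
    refine ⟨AdicCompletion.mk I R (AdicCompletion.AdicCauchySequence.mk I R r hcauchy), ?_⟩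
    refine (IsHausdorff.eq_iff_smodEq (I := J)).2 fun n => ?_
    rw [SModEq.sub_mem, smul_eq_mul, Ideal.mul_top, ← Ideal.Quotient.eq, hφ,
      AdicCompletion.evalₐ_mk]
    exact hgr n

theorem IsPrecomplete.span_of_forall_mem {A : Type*} [CommRing A] (l : List A)
    (h : ∀ x ∈ l, IsPrecomplete (Ideal.span {x}) A) :
    IsPrecomplete (Ideal.span {x | x ∈ l}) A := by
  induction l with
  | nil =>
    simp only [List.not_mem_nil, Set.ofPred_false, Ideal.span_empty]
    infer_instance
  | cons x l ih =>
    have : {y | y ∈ x :: l} = {x} ∪ {y | y ∈ l} := by ext; simp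
    rw [this, Ideal.span_union]
    exact (h x List.mem_cons_self).sup (ih fun y hy => h y (List.mem_cons_of_mem _ hy))

/-- The completion of a noetherian local ring is noetherian, and Tor-persistence ascends to it. -/
theorem isNoetherianRing_adicCompletion_and_torPersistent (R : Type u) [CommRing R]
    [IsNoetherianRing R] [IsLocalRing R] :
    IsNoetherianRing (AdicCompletion (maximalIdeal R) R) ∧
      (TorPersistent R → TorPersistent (AdicCompletion (maximalIdeal R) R)) := by
  obtain ⟨t, ht⟩ := (maximalIdeal R).fg_of_isNoetherianRing
  obtain ⟨S, _, _, _, _, _, hpre, hdec, htor⟩ :=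
    exists_faithfullyFlat_isPrecomplete_of_list t.toList fun x hx =>
      ht ▸ Ideal.subset_span (Finset.mem_toList.1 hx)
  let J := (maximalIdeal R).map (algebraMap R S)
  have hJ : J ≠ ⊤ := fun h => by
    have h1 := Ideal.comap_map_eq_self_of_faithfullyFlat (A := R) (B := S) (maximalIdeal R)
    rw [show (maximalIdeal R).map (algebraMap R S) = ⊤ from h, Ideal.comap_top] at h1
    exact (maximalIdeal.isMaximal R).ne_top h1.symm
  have hpreJ : IsPrecomplete J S := by
    have := IsPrecomplete.span_of_forall_mem (t.toList.map (algebraMap R S)) (by simpa using hpre)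
    convert this using 1
    simp only [J, ← ht]
    rw [Ideal.map_span]
    congr 1
    ext
    simp
  have : IsHausdorff J S := IsHausdorff.of_isLocalRing J S hJ
  have : IsAdicComplete J S := { __ := this, __ := hpreJ }
  obtain ⟨e⟩ := exists_algEquiv_adicCompletion (maximalIdeal R) hdec
  have hnoeth := isNoetherianRing_of_ringEquiv S e.symm.toRingEquiv
  refine ⟨hnoeth, fun h => ?_⟩
  let _ : Algebra (AdicCompletion (maximalIdeal R) R) S := (e : _ →+* S).toAlgebra
  let e' : AdicCompletion (maximalIdeal R) R ≃ₗ[AdicCompletion (maximalIdeal R) R] S :=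
    { e with map_smul' := fun a b => map_mul e a b }
  have := Module.FaithfullyFlat.of_linearEquiv _ _ e'.symm
  exact TorPersistent.of_faithfullyFlat _ S (htor h)

end AdicCompletion

/-- A commutative noetherian local ring `R` is Tor-persistent if and only if its
`𝔪`-adic completion `R̂` is Tor-persistent. -/
theorem torPersistent_iff_adicCompletion
    {R : Type u} [CommRing R] [IsNoetherianRing R] [IsLocalRing R] :
    TorPersistent R ↔
      TorPersistent (AdicCompletion (IsLocalRing.maximalIdeal R) R) := by
  obtain ⟨_, h⟩ := isNoetherianRing_adicCompletion_and_torPersistent R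
  have : Module.Flat R (AdicCompletion (IsLocalRing.maximalIdeal R) R) :=
    AdicCompletion.flat_of_isNoetherian _
  have : Module.FaithfullyFlat R (AdicCompletion (IsLocalRing.maximalIdeal R) R) :=
    Module.FaithfullyFlat.of_flat_of_isLocalHom
  exact ⟨h, TorPersistent.of_faithfullyFlat _ _⟩
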